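/- Let G be an abelian group and let Λ, Σ : ⊕_{i∈ℤ}G → ⊕_{i∈ℤ}G, G be the homomorphisms defined by (Λx)_i = x_{i−1} − x_i and Σ(x) = Σ_{i∈ℤ} x_i. Suppose H is a subgroup of ⊕_{i∈ℤ}G with Λ(H) ⊆ H, and let K = Σ(H) be the image of H under Σ, a subgroup of G. Then Λ and Σ induce homomorphisms Λ̄ : (⊕_{i∈ℤ}G)/H → (⊕_{i∈ℤ}G)/H and Σ̄ : (⊕_{i∈ℤ}G)/H → G/K, and the resulting sequence (⊕_{i∈ℤ}G)/H →^Λ̄ (⊕_{i∈ℤ}G)/H →^Σ̄ G/K → 0 is exact: Σ̄ is surjective and the kernel of Σ̄ equals the range of Λ̄. -/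

import Mathlib

namespace ShiftDifference

variable {G : Type*} [AddCommGroup G] {Λ : (ℤ →₀ G) →+ (ℤ →₀ G)} {S : (ℤ →₀ G) →+ G}

lemma sum_single (hS : ∀ x : ℤ →₀ G, S x = x.sum fun _ g => g) (i : ℤ) (g : G) :
    S (Finsupp.single i g) = g := by
  rw [hS, Finsupp.sum_single_index rfl]

lemma shift_single (hΛ : ∀ (x : ℤ →₀ G) (i : ℤ), Λ x i = x (i - 1) - x i) (i : ℤ) (g : G) :
    Λ (Finsupp.single i g) = Finsupp.single (i + 1) g - Finsupp.single i g := by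
  ext j
  simp only [hΛ, Finsupp.sub_apply, Finsupp.single_apply, eq_sub_iff_add_eq]

lemma sum_shift (hΛ : ∀ (x : ℤ →₀ G) (i : ℤ), Λ x i = x (i - 1) - x i)
    (hS : ∀ x : ℤ →₀ G, S x = x.sum fun _ g => g) (x : ℤ →₀ G) : S (Λ x) = 0 := by
  induction x using Finsupp.induction_linear with
  | zero => simp
  | add x y hx hy => simp [hx, hy]
  | single i g => simp [shift_single hΛ, sum_single hS]

lemma single_sub_single_mem_range
    (hΛ : ∀ (x : ℤ →₀ G) (i : ℤ), Λ x i = x (i - 1) - x i) (i : ℤ) (g : G) :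
    Finsupp.single i g - Finsupp.single 0 g ∈ Λ.range := by
  induction i using Int.induction_on with
  | zero => simp
  | succ n ih =>
    have h := add_mem (AddMonoidHom.mem_range.2 ⟨_, shift_single hΛ n g⟩) ih
    rwa [sub_add_sub_cancel] at h
  | pred n ih =>
    have h := sub_mem ih (AddMonoidHom.mem_range.2 ⟨_, shift_single hΛ (-n - 1) g⟩)
    rwa [sub_add_cancel, sub_sub_sub_cancel_left] at h

lemma sub_single_sum_mem_range (hΛ : ∀ (x : ℤ →₀ G) (i : ℤ), Λ x i = x (i - 1) - x i)
    (hS : ∀ x : ℤ →₀ G, S x = x.sum fun _ g => g) (x : ℤ →₀ G) :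
    x - Finsupp.single 0 (S x) ∈ Λ.range := by
  induction x using Finsupp.induction_linear with
  | zero => simp
  | add x y hx hy =>
    rw [map_add, Finsupp.single_add, add_sub_add_comm]
    exact add_mem hx hy
  | single i g =>
    rw [sum_single hS]
    exact single_sub_single_mem_range hΛ i g

/-- The sequence `⊕ G → ⊕ G → G` given by the shift difference and the sum is exact. -/
lemma ker_sum_eq_range_shift (hΛ : ∀ (x : ℤ →₀ G) (i : ℤ), Λ x i = x (i - 1) - x i)
    (hS : ∀ x : ℤ →₀ G, S x = x.sum fun _ g => g) : S.ker = Λ.range := by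
  ext x
  constructor
  · intro hx
    simpa [AddMonoidHom.mem_ker.1 hx] using sub_single_sum_mem_range hΛ hS x
  · rintro ⟨y, rfl⟩
    exact sum_shift hΛ hS y

end ShiftDifference

/-- Let `G` be an abelian group and `Λ, Σ` the homomorphisms on
`⊕_{i∈ℤ} G = (ℤ →₀ G)` given by `(Λ x) i = x (i-1) - x i` and `Σ x = ∑ i, x i`.
If `H` is a subgroup of `⊕_{i∈ℤ} G` with `Λ(H) ⊆ H` and `K = Σ(H)`, then `Λ` and `Σ`
induce homomorphisms `Λ̄ : (⊕G)/H → (⊕G)/H` and `Σ̄ : (⊕G)/H → G/K`, and the resulting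
sequence `(⊕G)/H →^Λ̄ (⊕G)/H →^Σ̄ G/K → 0` is exact: `Σ̄` is surjective and
`ker Σ̄ = range Λ̄`. -/
theorem stmt_1 {G : Type*} [AddCommGroup G]
    (Λ : (ℤ →₀ G) →+ (ℤ →₀ G)) (S : (ℤ →₀ G) →+ G)
    (hΛ : ∀ (x : ℤ →₀ G) (i : ℤ), Λ x i = x (i - 1) - x i)
    (hS : ∀ x : ℤ →₀ G, S x = x.sum fun _ g => g)
    (H : AddSubgroup (ℤ →₀ G)) (hH : ∀ x ∈ H, Λ x ∈ H) :
    ∃ (Λbar : ((ℤ →₀ G) ⧸ H) →+ ((ℤ →₀ G) ⧸ H))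
      (Sbar : ((ℤ →₀ G) ⧸ H) →+ (G ⧸ H.map S)),
      (∀ x : ℤ →₀ G, Λbar (QuotientAddGroup.mk x) = QuotientAddGroup.mk (Λ x)) ∧
      (∀ x : ℤ →₀ G, Sbar (QuotientAddGroup.mk x) = QuotientAddGroup.mk (S x)) ∧
      Function.Surjective Sbar ∧ Sbar.ker = Λbar.range := by
  have hcomap : H ≤ H.comap Λ := hH
  refine ⟨QuotientAddGroup.map H H Λ hcomap,
    QuotientAddGroup.map H (H.map S) S (H.le_comap_map S), fun _ => rfl, fun _ => rfl, ?_, ?_⟩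
  · intro q
    obtain ⟨g, rfl⟩ := QuotientAddGroup.mk_surjective q
    refine ⟨QuotientAddGroup.mk (Finsupp.single 0 g), ?_⟩
    exact congrArg QuotientAddGroup.mk (ShiftDifference.sum_single hS 0 g)
  · ext q
    obtain ⟨x, rfl⟩ := QuotientAddGroup.mk_surjective q
    constructor
    · intro hx
      obtain ⟨h, hh, hSh⟩ := (QuotientAddGroup.eq_zero_iff (S x)).1 hx
      have hker : x - h ∈ S.ker := by rw [AddMonoidHom.mem_ker, map_sub, hSh, sub_self]
      rw [ShiftDifference.ker_sum_eq_range_shift hΛ hS] at hker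
      obtain ⟨y, hy⟩ := hker
      refine ⟨QuotientAddGroup.mk y, ?_⟩
      rw [QuotientAddGroup.map_mk, hy, QuotientAddGroup.mk_sub,
        (QuotientAddGroup.eq_zero_iff h).2 hh, sub_zero]
    · rintro ⟨p, hp⟩
      obtain ⟨y, rfl⟩ := QuotientAddGroup.mk_surjective p
      rw [← hp, AddMonoidHom.mem_ker, QuotientAddGroup.map_mk, QuotientAddGroup.map_mk,
        ShiftDifference.sum_shift hΛ hS, QuotientAddGroup.mk_zero]
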